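/- arXiv:2409.07800 — 2 statements merged into one kernel-verified Lean document; each statement's English description precedes it below -/
import Mathlib

section
/- Let (X_n)_{n≥0} be a real-valued stochastic approximation algorithm, let g : ℝ → ℝ be non-increasing with a zero x* such that g(x) > 0 for x < x* and g(x) < 0 for x > x*, and suppose the limit K_{gu} := lim_{x→−∞} g(x) exists, is finite and positive. If K_{gu} > K_u, then for every ε > 0 there exists a constant a > 0, independent of n, such that for all sufficiently large n, ℙ(X_{n+1} − x* < −ε) ≤ e^{−a n}. -/
open MeasureTheory Filter Set

/-- The deterministic constraints satisfied by almost every trajectory of a stochastic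
approximation algorithm with drift `g`, steps `c` and noise `u`. -/
structure IsApproximationPath (g : ℝ → ℝ) (x0 ul uu Ku : ℝ) (x c u : ℕ → ℝ) : Prop where
  zero : x 0 = x0
  succ : ∀ n, x (n + 1) = x n + c (n + 1) * (g (x n) + u (n + 1))
  lower : ∀ n : ℕ, ul / ((n : ℝ) + 1) ≤ c (n + 1)
  upper : ∀ n : ℕ, c (n + 1) ≤ uu / ((n : ℝ) + 1)
  noise : ∀ n, |u (n + 1)| ≤ Ku

namespace IsApproximationPath

variable {g : ℝ → ℝ} {x0 ul uu Ku : ℝ} {x c u : ℕ → ℝ}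

lemma step_nonneg (h : IsApproximationPath g x0 ul uu Ku x c u) (hul : 0 < ul) (n : ℕ) :
    0 ≤ c (n + 1) :=
  le_trans (by positivity) (h.lower n)

lemma step_le (h : IsApproximationPath g x0 ul uu Ku x c u) (huu : 0 < uu) (n : ℕ) :
    c (n + 1) ≤ uu :=
  (h.upper n).trans (div_le_self huu.le (by linarith [n.cast_nonneg (α := ℝ)]))

/-- If the drift drops below `-Ku`, paths are bounded above; otherwise the drift is bounded below
anyway. -/
lemma exists_le_drift (hul : 0 < ul) (huu : 0 < uu) (hKu : 0 < Ku) (hg : Antitone g) {K : ℝ}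
    (hK : 0 < K) (hgK : ∀ y, g y ≤ K) :
    ∃ L > 0, ∀ x c u, IsApproximationPath g x0 ul uu Ku x c u → ∀ n, -L ≤ g (x n) := by
  by_cases hlow : ∃ y, g y < -Ku
  · obtain ⟨y, hy⟩ := hlow
    refine ⟨|g (max x0 (y + uu * (K + Ku)))| + 1, by positivity, fun x c u h n ↦ ?_⟩
    have hM : x n ≤ max x0 (y + uu * (K + Ku)) := by
      induction n with
      | zero => exact h.zero.le.trans (le_max_left _ _)
      | succ n ih =>
        have hu := abs_le.1 (h.noise n)
        have hc := h.step_nonneg hul n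
        rw [h.succ]
        rcases le_total (x n) y with hxy | hxy
        · have h1 : c (n + 1) * (g (x n) + u (n + 1)) ≤ uu * (K + Ku) :=
            mul_le_mul_of_nonneg (h.step_le huu n) (by linarith [hgK (x n)]) hc (by linarith)
          exact le_max_of_le_right (by linarith)
        · have h1 : c (n + 1) * (g (x n) + u (n + 1)) ≤ 0 :=
            mul_nonpos_of_nonneg_of_nonpos hc (by linarith [hg hxy])
          linarith
    linarith [hg hM, neg_abs_le (g (max x0 (y + uu * (K + Ku))))]
  · push Not at hlow
    exact ⟨Ku, hKu, fun x c u _ n ↦ hlow _⟩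

/-- Paths are uniformly bounded below when the drift exceeds the noise far to the left. -/
lemma exists_le (hul : 0 < ul) (huu : 0 < uu) (hg : Antitone g) {L y : ℝ} (hL : 0 < L)
    (hKu : 0 < Ku) (hy : Ku ≤ g y)
    (hgL : ∀ x c u, IsApproximationPath g x0 ul uu Ku x c u → ∀ n, -L ≤ g (x n)) :
    ∃ b, ∀ x c u, IsApproximationPath g x0 ul uu Ku x c u → ∀ n, b ≤ x n := by
  refine ⟨min x0 (y - uu * (L + Ku)), fun x c u h n ↦ ?_⟩
  induction n with
  | zero => exact (min_le_left _ _).trans h.zero.ge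
  | succ n ih =>
    have hu := abs_le.1 (h.noise n)
    have hc := h.step_nonneg hul n
    rw [h.succ]
    rcases le_total (x n) y with hxy | hxy
    · have h1 : 0 ≤ c (n + 1) * (g (x n) + u (n + 1)) :=
        mul_nonneg hc (by linarith [hg hxy])
      linarith
    · have h1 : c (n + 1) * -(g (x n) + u (n + 1)) ≤ uu * (L + Ku) :=
        mul_le_mul_of_nonneg (h.step_le huu n) (by linarith [hgL x c u h n]) hc (by linarith)
      exact min_le_of_right_le (by linarith)

lemma sub_eq_sum (h : IsApproximationPath g x0 ul uu Ku x c u) {k m : ℕ} (hkm : k ≤ m) :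
    x m - x k = ∑ j ∈ Finset.Ico k m, c (j + 1) * g (x j)
      + ∑ j ∈ Finset.Ico k m, c (j + 1) * u (j + 1) := by
  rw [← Finset.sum_add_distrib, ← Finset.sum_Ico_sub x hkm]
  refine Finset.sum_congr rfl fun j _ ↦ ?_
  rw [h.succ]
  ring

end IsApproximationPath

lemma log_sub_log_le_sum_Ico_inv {k m : ℕ} (hkm : k ≤ m) :
    Real.log ((m : ℝ) + 1) - Real.log ((k : ℝ) + 1)
      ≤ ∑ j ∈ Finset.Ico k m, 1 / ((j : ℝ) + 1) := by
  have := Finset.sum_Ico_sub (fun j : ℕ ↦ Real.log ((j : ℝ) + 1)) hkm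
  rw [← this]
  refine Finset.sum_le_sum fun j _ ↦ ?_
  have hj : (0 : ℝ) < (j : ℝ) + 1 := by positivity
  push_cast
  rw [← Real.log_div (by positivity) (by positivity)]
  refine (Real.log_le_sub_one_of_pos (by positivity)).trans (le_of_eq ?_)
  field_simp
  ring

/-- A path lying well below the root at a late time `n + 1` forces a large negative partial sum
of the noise over a window starting after a fixed proportion of that time. -/
lemma exists_noise_sum_le {g : ℝ → ℝ} {x0 ul uu Ku L b xstar ε : ℝ} (hul : 0 < ul) (huu : 0 < uu)
    (hg : Antitone g) (hg_pos : ∀ y < xstar, 0 < g y) (hL : 0 < L) (hε : 0 < ε)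
    (hgL : ∀ x c u, IsApproximationPath g x0 ul uu Ku x c u → ∀ n, -L ≤ g (x n))
    (hb : ∀ x c u, IsApproximationPath g x0 ul uu Ku x c u → ∀ n, b ≤ x n) :
    ∃ N : ℕ, 0 < N ∧ ∀ᶠ n : ℕ in atTop, ∀ x c u, IsApproximationPath g x0 ul uu Ku x c u →
      x (n + 1) - xstar < -ε →
      ∃ k ∈ Finset.Icc (n / N) n,
        ∑ j ∈ Finset.Ico k (n + 1), c (j + 1) * u (j + 1) ≤ -(ε / 4) := by
  set η := g (xstar - ε / 2) with hη
  have hηpos : 0 < η := hg_pos _ (by linarith)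
  obtain ⟨N, hN⟩ := exists_nat_ge (2 * Real.exp ((xstar - b) / (ul * η)))
  have hNpos : (0 : ℝ) < N := lt_of_lt_of_le (by positivity) hN
  have hN0 : 0 < N := by exact_mod_cast hNpos
  refine ⟨N, hN0, ?_⟩
  filter_upwards [eventually_ge_atTop N, eventually_ge_atTop 1,
    eventually_ge_atTop ⌈4 * uu * L * N / ε⌉₊] with n hnN hn1 hnε x c u h hx
  have hn0 : (0 : ℝ) < n := by exact_mod_cast hn1
  have hdiv : n / N ≤ n := Nat.div_le_self _ _
  have hdivle : ((n / N : ℕ) : ℝ) ≤ n / N := Nat.cast_div_le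
  have hdivge : (n : ℝ) / N ≤ ((n / N : ℕ) : ℝ) + 1 := by
    rw [div_le_iff₀' hNpos]
    exact_mod_cast (Nat.lt_mul_div_succ n hN0).le
  have hleft : ∀ j, x j < xstar - ε / 2 → ul * η * (1 / ((j : ℝ) + 1)) ≤ c (j + 1) * g (x j) := by
    intro j hj
    calc ul * η * (1 / ((j : ℝ) + 1)) = ul / ((j : ℝ) + 1) * η := by ring
      _ ≤ c (j + 1) * g (x j) :=
        mul_le_mul (h.lower j) (hg hj.le) hηpos.le (h.step_nonneg hul j)
  by_cases hall : ∀ j ∈ Finset.Icc (n / N) n, x j < xstar - ε / 2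
  · refine ⟨n / N, Finset.mem_Icc.2 ⟨le_rfl, hdiv⟩, ?_⟩
    have hsub := h.sub_eq_sum (hdiv.trans n.le_succ)
    have hdrift : ul * η * ∑ j ∈ Finset.Ico (n / N) (n + 1), 1 / ((j : ℝ) + 1)
        ≤ ∑ j ∈ Finset.Ico (n / N) (n + 1), c (j + 1) * g (x j) := by
      rw [Finset.mul_sum]
      refine Finset.sum_le_sum fun j hj ↦ hleft j (hall j ?_)
      rw [Finset.mem_Ico] at hj
      exact Finset.mem_Icc.2 ⟨hj.1, by lia⟩
    have hlog : (xstar - b) / (ul * η)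
        ≤ ∑ j ∈ Finset.Ico (n / N) (n + 1), 1 / ((j : ℝ) + 1) := by
      refine le_trans ?_ (log_sub_log_le_sum_Ico_inv (hdiv.trans n.le_succ))
      rw [← Real.log_div (by positivity) (by positivity), Real.le_log_iff_exp_le (by positivity),
        le_div_iff₀ (by positivity)]
      have h1 : ((n / N : ℕ) : ℝ) + 1 ≤ 2 * (n / N) := by
        have : (1 : ℝ) ≤ n / N := by
          rw [le_div_iff₀ hNpos]; simpa using (by exact_mod_cast hnN : (N : ℝ) ≤ n)
        linarith
      calc Real.exp ((xstar - b) / (ul * η)) * (((n / N : ℕ) : ℝ) + 1)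
          ≤ (N / 2) * (2 * (n / N)) := by
            refine mul_le_mul (by linarith) h1 (by positivity) (by positivity)
        _ = n := by field_simp
        _ ≤ ((n + 1 : ℕ) : ℝ) + 1 := by push_cast; linarith
    rw [div_le_iff₀' (by positivity)] at hlog
    linarith [hb x c u h (n / N)]
  · push Not at hall
    obtain ⟨k₀, hk₀, hxk₀⟩ := hall
    obtain ⟨k, hk, hkmax⟩ := Finset.exists_max_image
      ({j ∈ Finset.Icc (n / N) n | xstar - ε / 2 ≤ x j}) id ⟨k₀, Finset.mem_filter.2 ⟨hk₀, hxk₀⟩⟩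
    rw [Finset.mem_filter, Finset.mem_Icc] at hk
    obtain ⟨⟨hk1, hk2⟩, hxk⟩ := hk
    refine ⟨k, Finset.mem_Icc.2 ⟨hk1, hk2⟩, ?_⟩
    have hsub := h.sub_eq_sum (hk2.trans n.le_succ)
    rw [Finset.sum_eq_sum_Ico_succ_bot (Nat.lt_succ_of_le hk2) (fun j ↦ c (j + 1) * g (x j))]
      at hsub
    have hrest : 0 ≤ ∑ j ∈ Finset.Ico (k + 1) (n + 1), c (j + 1) * g (x j) := by
      refine Finset.sum_nonneg fun j hj ↦ le_trans (by positivity) (hleft j ?_)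
      rw [Finset.mem_Ico] at hj
      by_contra! hxj
      have := hkmax j (Finset.mem_filter.2 ⟨Finset.mem_Icc.2 ⟨by lia, by lia⟩, hxj⟩)
      simp only [id] at this
      lia
    have hfirst : c (k + 1) * -g (x k) ≤ ε / 4 := by
      have hkn : (n : ℝ) / N ≤ (k : ℝ) + 1 := hdivge.trans (by gcongr)
      calc c (k + 1) * -g (x k) ≤ uu / ((k : ℝ) + 1) * L :=
            mul_le_mul_of_nonneg (h.upper k) (by linarith [hgL x c u h k])
              (h.step_nonneg hul k) hL.le
        _ ≤ uu / (n / N) * L := by gcongr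
        _ ≤ ε / 4 := by
            have := Nat.ceil_le.1 hnε
            rw [div_le_iff₀ hε] at this
            rw [div_div_eq_mul_div, div_mul_eq_mul_div, div_le_iff₀ hn0]
            linarith
    linarith

section ExponentialMoment

variable {Ω : Type*} {m m0 : MeasurableSpace Ω} {μ : Measure Ω}

/-- One conditioning step for the exponential moment of a small, almost centred variable. -/
lemma integral_mul_exp_le [IsProbabilityMeasure μ] (hm : m ≤ m0) {V Z : Ω → ℝ} {B t r d : ℝ}
    (hV : Measurable[m] V) (hV0 : ∀ ω, 0 ≤ V ω) (hVB : ∀ᵐ ω ∂μ, V ω ≤ B)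
    (hZ : Measurable Z) (hZr : ∀ᵐ ω ∂μ, |Z ω| ≤ r) (hZd : ∀ᵐ ω ∂μ, |(μ[Z | m]) ω| ≤ d)
    (ht : 0 ≤ t) (htr : t * r ≤ 1) :
    ∫ ω, V ω * Real.exp (-t * Z ω) ∂μ ≤ Real.exp (t * d + (t * r) ^ 2) * ∫ ω, V ω ∂μ := by
  have hVm : Measurable V := hV.mono hm le_rfl
  have hVint : Integrable V μ := .of_bound hVm.aestronglyMeasurable B (by
    filter_upwards [hVB] with ω h; rwa [Real.norm_eq_abs, abs_of_nonneg (hV0 ω)])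
  have hZint : Integrable Z μ := .of_bound hZ.aestronglyMeasurable r hZr
  have hVZint : Integrable (V * Z) μ :=
    hVint.mul_bdd hZ.aestronglyMeasurable hZr
  have hcond : -(d * ∫ ω, V ω ∂μ) ≤ ∫ ω, (V * Z) ω ∂μ := by
    rw [← integral_condExp (f := V * Z) hm, ← integral_const_mul, ← integral_neg]
    refine integral_mono_ae (hVint.const_mul d).neg integrable_condExp ?_
    filter_upwards [hZd, condExp_mul_of_stronglyMeasurable_left hV.stronglyMeasurable hVZint hZint]
      with ω h1 h2
    rw [h2, Pi.mul_apply]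
    nlinarith [hV0 ω, (abs_le.1 h1).1]
  have hexp : ∀ᵐ ω ∂μ, V ω * Real.exp (-t * Z ω)
      ≤ (1 + (t * r) ^ 2) * V ω - t * (V * Z) ω := by
    filter_upwards [hZr] with ω h
    have h1 : |-t * Z ω| ≤ t * r := by
      rw [abs_mul, abs_neg, abs_of_nonneg ht]; gcongr
    have h2 := (abs_le.1 (Real.abs_exp_sub_one_sub_id_le (h1.trans htr))).2
    have h3 : (-t * Z ω) ^ 2 ≤ (t * r) ^ 2 := sq_le_sq.2 (h1.trans (le_abs_self _))
    have h4 := mul_le_mul_of_nonneg_left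
      (by linarith : Real.exp (-t * Z ω) ≤ 1 + -t * Z ω + (t * r) ^ 2) (hV0 ω)
    rw [Pi.mul_apply]
    linarith
  have hint : Integrable (fun ω ↦ (1 + (t * r) ^ 2) * V ω - t * (V * Z) ω) μ :=
    (hVint.const_mul _).sub (hVZint.const_mul _)
  have hnn : 0 ≤ ∫ ω, V ω ∂μ := integral_nonneg hV0
  calc ∫ ω, V ω * Real.exp (-t * Z ω) ∂μ
      ≤ ∫ ω, ((1 + (t * r) ^ 2) * V ω - t * (V * Z) ω) ∂μ :=
        integral_mono_of_nonneg
          (ae_of_all _ fun ω ↦ mul_nonneg (hV0 ω) (Real.exp_nonneg _)) hint hexp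
    _ = (1 + (t * r) ^ 2) * ∫ ω, V ω ∂μ - t * ∫ ω, (V * Z) ω ∂μ := by
        rw [integral_sub (hVint.const_mul _) (hVZint.const_mul _), integral_const_mul,
          integral_const_mul]
    _ ≤ (t * d + (t * r) ^ 2 + 1) * ∫ ω, V ω ∂μ := by
        linarith [mul_le_mul_of_nonneg_left hcond ht]
    _ ≤ _ := mul_le_mul_of_nonneg_right (Real.add_one_le_exp _) hnn

variable {ℱ : Filtration ℕ m0} {Z : ℕ → Ω → ℝ} {r d : ℝ}

lemma ae_abs_sum_Ico_le (hr : 0 ≤ r) (hZr : ∀ j : ℕ, 1 ≤ j → ∀ᵐ ω ∂μ, |Z (j + 1) ω| ≤ r / j)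
    {k : ℕ} (hk : 1 ≤ k) (m : ℕ) :
    ∀ᵐ ω ∂μ, |∑ j ∈ Finset.Ico k m, Z (j + 1) ω| ≤ (m - k : ℕ) * r := by
  have hall : ∀ᵐ ω ∂μ, ∀ j : ℕ, 1 ≤ j → |Z (j + 1) ω| ≤ r / j := by
    rw [ae_all_iff]
    intro j
    by_cases hj : 1 ≤ j
    · filter_upwards [hZr j hj] with ω h _ using h
    · exact ae_of_all _ fun ω h ↦ absurd h hj
  filter_upwards [hall] with ω h
  refine (Finset.abs_sum_le_sum_abs _ _).trans ?_
  rw [← nsmul_eq_mul, ← Nat.card_Ico k m]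
  refine Finset.sum_le_card_nsmul _ _ _ fun j hj ↦ ?_
  have hj1 : 1 ≤ j := hk.trans (Finset.mem_Ico.1 hj).1
  exact (h j hj1).trans (div_le_self hr (by exact_mod_cast hj1))

lemma measurable_sum_Ico (hZ : ∀ j, Measurable[ℱ j] (Z j)) (k m : ℕ) :
    Measurable[ℱ m] fun ω ↦ ∑ j ∈ Finset.Ico k m, Z (j + 1) ω :=
  Finset.measurable_fun_sum _ fun j hj ↦
    (hZ (j + 1)).mono (ℱ.mono (Nat.succ_le_of_lt (Finset.mem_Ico.1 hj).2)) le_rfl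

lemma ae_exp_sum_Ico_le (hr : 0 ≤ r)
    (hZr : ∀ j : ℕ, 1 ≤ j → ∀ᵐ ω ∂μ, |Z (j + 1) ω| ≤ r / j)
    {t : ℝ} (ht : 0 ≤ t) {k : ℕ} (hk : 1 ≤ k) (m : ℕ) :
    ∀ᵐ ω ∂μ, Real.exp (-t * ∑ j ∈ Finset.Ico k m, Z (j + 1) ω)
      ≤ Real.exp (t * ((m - k : ℕ) * r)) := by
  filter_upwards [ae_abs_sum_Ico_le hr hZr hk m] with ω h
  refine Real.exp_le_exp.2 ?_
  nlinarith [mul_le_mul_of_nonneg_left (abs_le.1 h).1 ht]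

lemma integral_exp_sum_Ico_le [IsProbabilityMeasure μ]
    (hZ : ∀ j, Measurable[ℱ j] (Z j)) (hr : 0 ≤ r)
    (hZr : ∀ j : ℕ, 1 ≤ j → ∀ᵐ ω ∂μ, |Z (j + 1) ω| ≤ r / j)
    (hZd : ∀ j : ℕ, 1 ≤ j → ∀ᵐ ω ∂μ, |(μ[Z (j + 1) | ℱ j]) ω| ≤ d / (j : ℝ) ^ 2)
    {t : ℝ} (ht : 0 ≤ t) {k : ℕ} (hk : 1 ≤ k) (htk : t * r ≤ k) {m : ℕ} (hkm : k ≤ m) :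
    ∫ ω, Real.exp (-t * ∑ j ∈ Finset.Ico k m, Z (j + 1) ω) ∂μ
      ≤ Real.exp ((t * d + (t * r) ^ 2) * ∑ j ∈ Finset.Ico k m, ((j : ℝ) ^ 2)⁻¹) := by
  induction m, hkm using Nat.le_induction with
  | base => simp
  | succ m hkm ih =>
    have hm1 : 1 ≤ m := hk.trans hkm
    have hm0 : (0 : ℝ) < m := by exact_mod_cast hm1
    have htm : t * (r / m) ≤ 1 := by
      rw [← mul_div_assoc, div_le_one hm0]
      exact htk.trans (by exact_mod_cast hkm)
    have hstep := integral_mul_exp_le (ℱ.le m)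
      (V := fun ω ↦ Real.exp (-t * ∑ j ∈ Finset.Ico k m, Z (j + 1) ω))
      (Real.measurable_exp.comp ((measurable_sum_Ico hZ k m).const_mul _))
      (fun _ ↦ Real.exp_nonneg _) (ae_exp_sum_Ico_le hr hZr ht hk m)
      ((hZ (m + 1)).mono (ℱ.le _) le_rfl) (hZr m hm1) (hZd m hm1) ht htm
    calc ∫ ω, Real.exp (-t * ∑ j ∈ Finset.Ico k (m + 1), Z (j + 1) ω) ∂μ
        = ∫ ω, Real.exp (-t * ∑ j ∈ Finset.Ico k m, Z (j + 1) ω)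
            * Real.exp (-t * Z (m + 1) ω) ∂μ := by
          refine integral_congr_ae (ae_of_all _ fun ω ↦ ?_)
          simp only
          rw [← Real.exp_add, Finset.sum_Ico_succ_top hkm, mul_add]
      _ ≤ _ := hstep
      _ ≤ _ := mul_le_mul_of_nonneg_left ih (Real.exp_nonneg _)
      _ = _ := by
          rw [← Real.exp_add, Finset.sum_Ico_succ_top hkm]
          congr 1
          field_simp
          ring

/-- Chernoff bound for sums of almost centred increments of size `O(1 / j)`. -/
lemma measureReal_sum_Ico_le_le [IsProbabilityMeasure μ]
    (hZ : ∀ j, Measurable[ℱ j] (Z j)) (hr : 0 ≤ r) (hd : 0 ≤ d)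
    (hZr : ∀ j : ℕ, 1 ≤ j → ∀ᵐ ω ∂μ, |Z (j + 1) ω| ≤ r / j)
    (hZd : ∀ j : ℕ, 1 ≤ j → ∀ᵐ ω ∂μ, |(μ[Z (j + 1) | ℱ j]) ω| ≤ d / (j : ℝ) ^ 2)
    {t : ℝ} (ht : 0 ≤ t) {k : ℕ} (hk : 1 ≤ k) (htk : t * r ≤ k) {m : ℕ} (hkm : k ≤ m) (s : ℝ) :
    μ.real {ω | ∑ j ∈ Finset.Ico k m, Z (j + 1) ω ≤ -s}
      ≤ Real.exp (-(t * s) + (t * d + (t * r) ^ 2) * (2 / k)) := by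
  have hint : Integrable (fun ω ↦ Real.exp (-t * ∑ j ∈ Finset.Ico k m, Z (j + 1) ω)) μ :=
    .of_bound ((Real.measurable_exp.comp
      ((measurable_sum_Ico hZ k m).const_mul _)).mono (ℱ.le m) le_rfl).aestronglyMeasurable _ (by
        filter_upwards [ae_exp_sum_Ico_le hr hZr ht hk m] with ω h
        rwa [Real.norm_eq_abs, Real.abs_exp])
  have hmarkov := ProbabilityTheory.measure_le_le_exp_mul_mgf (μ := μ)
    (X := fun ω ↦ ∑ j ∈ Finset.Ico k m, Z (j + 1) ω) (-s) (neg_nonpos.2 ht) hint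
  have hsum : ∑ j ∈ Finset.Ico k m, ((j : ℝ) ^ 2)⁻¹ ≤ 2 / k := by
    obtain ⟨l, rfl⟩ := Nat.exists_eq_add_of_le' hk
    have := sum_Ioo_inv_sq_le (α := ℝ) l m
    rw [← Finset.Ico_succ_left_eq_Ioo] at this
    simpa using this
  refine hmarkov.trans ?_
  rw [Real.exp_add]
  refine mul_le_mul (Real.exp_le_exp.2 (by linarith)) ?_ ProbabilityTheory.mgf_nonneg
    (Real.exp_nonneg _)
  refine (integral_exp_sum_Ico_le hZ hr hZr hZd ht hk htk hkm).trans (Real.exp_le_exp.2 ?_)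
  gcongr

end ExponentialMoment

lemma eventually_mul_exp_le_exp {a : ℝ} (ha : 0 < a) (C : ℝ) :
    ∀ᶠ n : ℕ in atTop, ((n : ℝ) + 1) * Real.exp (C - 2 * a * n) ≤ Real.exp (-a * n) := by
  have h1 := (Real.tendsto_pow_mul_exp_neg_atTop_nhds_zero 1).comp
    ((tendsto_natCast_atTop_atTop (R := ℝ)).atTop_mul_const ha)
  have hC : (0 : ℝ) < a / (2 * Real.exp C) := by positivity
  filter_upwards [h1.eventually_lt_const hC, eventually_ge_atTop 1] with n hn hn1
  have hn1' : (1 : ℝ) ≤ n := by exact_mod_cast hn1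
  simp only [Function.comp, pow_one] at hn
  rw [lt_div_iff₀ (by positivity)] at hn
  have h2 : (n : ℝ) * (2 * Real.exp C * Real.exp (-(n * a))) ≤ 1 := by
    by_contra! h
    nlinarith
  have h3 : Real.exp (C - 2 * a * n) = Real.exp C * Real.exp (-(n * a)) * Real.exp (-a * n) := by
    rw [← Real.exp_add, ← Real.exp_add]; ring_nf
  rw [h3, ← mul_assoc]
  refine mul_le_of_le_one_left (Real.exp_nonneg _) (le_trans ?_ h2)
  have : 0 ≤ Real.exp C * Real.exp (-(n * a)) := by positivity
  nlinarith

/-- Lower tail large deviation inequality for an unbounded stochastic approximation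
algorithm in the case K_{gu} > K_u. -/
theorem sa_lower_tail_large_Kgu
    {Ω : Type*} {m0 : MeasurableSpace Ω} {ℙ : Measure Ω} [IsProbabilityMeasure ℙ]
    (ℱ : Filtration ℕ m0)
    (X γ U : ℕ → Ω → ℝ) (g : ℝ → ℝ) (x0 : ℝ)
    (hX_meas : ∀ n : ℕ, Measurable[ℱ n] (X n))
    (hγ_meas : ∀ n : ℕ, Measurable[ℱ n] (γ n))
    (hU_meas : ∀ n : ℕ, Measurable[ℱ n] (U n))
    (hX0 : ∀ ω, X 0 ω = x0)
    (hrec : ∀ (n : ℕ) ω, X (n + 1) ω = X n ω + γ (n + 1) ω * (g (X n ω) + U (n + 1) ω))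
    (ul uu Ku Ke : ℝ) (hul : 0 < ul) (huu : 0 < uu) (hKu : 0 < Ku) (hKe : 0 < Ke)
    (hγ_bound : ∀ n : ℕ, 1 ≤ n → ∀ᵐ ω ∂ℙ, ul / n ≤ γ n ω ∧ γ n ω ≤ uu / n)
    (hU_bound : ∀ n : ℕ, ∀ᵐ ω ∂ℙ, |U (n + 1) ω| ≤ Ku)
    (hcond : ∀ n : ℕ, 1 ≤ n →
      ∀ᵐ ω ∂ℙ, |(ℙ[fun ω' => γ (n + 1) ω' * U (n + 1) ω' | ℱ n]) ω| ≤ Ke / (n : ℝ) ^ 2)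
    (hg_anti : Antitone g)
    (xstar : ℝ) (hxs_zero : g xstar = 0)
    (hg_pos : ∀ x < xstar, 0 < g x) (hg_neg : ∀ x, xstar < x → g x < 0)
    (Kgu : ℝ) (hKgu : 0 < Kgu)
    (hlim : Tendsto g atBot (nhds Kgu))
    (hcase : Ku < Kgu) :
    ∀ ε > (0:ℝ), ∃ a > (0:ℝ), ∀ᶠ n in atTop,
      ℙ {ω | X (n + 1) ω - xstar < -ε} ≤ ENNReal.ofReal (Real.exp (-a * n)) := by
  have hgK : ∀ y, g y ≤ Kgu := hg_anti.ge_of_tendsto hlim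
  obtain ⟨y, hy⟩ := (hlim.eventually_const_lt hcase).exists
  obtain ⟨L, hL, hgL⟩ := IsApproximationPath.exists_le_drift (x0 := x0) hul huu hKu hg_anti hKgu hgK
  obtain ⟨b, hb⟩ := IsApproximationPath.exists_le hul huu hg_anti hL hKu hy.le hgL
  intro ε hε
  obtain ⟨N, hN, hev⟩ := exists_noise_sum_le hul huu hg_anti hg_pos hL hε hgL hb
  have hpath : ∀ᵐ ω ∂ℙ, IsApproximationPath g x0 ul uu Ku (X · ω) (γ · ω) (U · ω) := by
    have hγ' : ∀ᵐ ω ∂ℙ, ∀ n : ℕ,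
        ul / ((n : ℝ) + 1) ≤ γ (n + 1) ω ∧ γ (n + 1) ω ≤ uu / ((n : ℝ) + 1) :=
      ae_all_iff.2 fun n ↦ by simpa using hγ_bound (n + 1) (Nat.le_add_left 1 n)
    filter_upwards [hγ', ae_all_iff.2 hU_bound] with ω h1 h2
    exact ⟨hX0 ω, fun n ↦ hrec n ω, fun n ↦ (h1 n).1, fun n ↦ (h1 n).2, h2⟩
  set r := uu * Ku with hr_def
  have hr : 0 < r := by positivity
  set Z : ℕ → Ω → ℝ := fun n ω ↦ γ n ω * U n ω with hZ_def
  have hZ : ∀ j, Measurable[ℱ j] (Z j) := fun j ↦ (hγ_meas j).mul (hU_meas j)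
  have hZr : ∀ j : ℕ, 1 ≤ j → ∀ᵐ ω ∂ℙ, |Z (j + 1) ω| ≤ r / j := by
    intro j hj
    filter_upwards [hpath] with ω h
    have hj0 : (0 : ℝ) < j := by exact_mod_cast hj
    have h1 : γ (j + 1) ω ≤ uu / j := (h.upper j).trans (by gcongr; linarith)
    have h2 : 0 ≤ γ (j + 1) ω := h.step_nonneg hul j
    calc |Z (j + 1) ω| = γ (j + 1) ω * |U (j + 1) ω| := by
          rw [hZ_def, abs_mul, abs_of_nonneg h2]
      _ ≤ uu / j * Ku := mul_le_mul h1 (h.noise j) (abs_nonneg _) (by positivity)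
      _ = r / j := by ring
  have hN0 : (0 : ℝ) < N := by exact_mod_cast hN
  obtain ⟨θ, hθ, hθ1, hθ2⟩ : ∃ θ > 0, θ * r ≤ 1 / (2 * N) ∧ 4 * N * (θ * r ^ 2) ≤ ε / 8 := by
    refine ⟨min (1 / (2 * N) / r) (ε / (32 * N * r ^ 2)), by positivity, ?_, ?_⟩
    · exact (le_div_iff₀ hr).1 (min_le_left _ _)
    · have := (le_div_iff₀ (by positivity)).1
        (min_le_right (1 / (2 * N) / r) (ε / (32 * N * r ^ 2)))
      linarith
  refine ⟨θ * ε / 16, by positivity, ?_⟩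
  filter_upwards [hev, eventually_ge_atTop (2 * N),
    eventually_mul_exp_le_exp (show 0 < θ * ε / 16 by positivity) (4 * N * (θ * Ke))]
    with n hn hnN hexp
  have hn0 : (0 : ℝ) < n := by exact_mod_cast (by lia : 0 < n)
  have hwindow : ∀ k ∈ Finset.Icc (n / N) n, ℙ.real {ω |
      ∑ j ∈ Finset.Ico k (n + 1), Z (j + 1) ω ≤ -(ε / 4)}
      ≤ Real.exp (4 * N * (θ * Ke) - 2 * (θ * ε / 16) * n) := by
    intro k hk
    obtain ⟨hk1, hk2⟩ := Finset.mem_Icc.1 hk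
    have hkone : 1 ≤ k := le_trans ((Nat.one_le_div_iff hN).2 (by lia)) hk1
    have hk0 : (0 : ℝ) < k := by exact_mod_cast hkone
    have hkn : (n : ℝ) / (2 * N) ≤ k := by
      rw [div_le_iff₀ (by positivity)]
      have h1 : n < N * (k + 1) := (Nat.lt_mul_div_succ n hN).trans_le (by gcongr)
      have h2 : N * (k + 1) ≤ k * (2 * N) := by nlinarith
      exact_mod_cast h1.le.trans h2
    have htk : θ * n * r ≤ k := by
      calc θ * n * r = θ * r * n := by ring
        _ ≤ 1 / (2 * N) * n := by gcongr
        _ = n / (2 * N) := by ring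
        _ ≤ k := hkn
    refine (measureReal_sum_Ico_le_le hZ hr.le hKe.le hZr hcond (by positivity : 0 ≤ θ * n) hkone
      htk (hk2.trans n.le_succ) (ε / 4)).trans (Real.exp_le_exp.2 ?_)
    have h2k : 2 / (k : ℝ) ≤ 4 * N / n := by
      rw [div_le_div_iff₀ hk0 hn0]
      rw [div_le_iff₀ (by positivity)] at hkn
      linarith
    calc -(θ * n * (ε / 4)) + (θ * n * Ke + (θ * n * r) ^ 2) * (2 / k)
        ≤ -(θ * n * (ε / 4)) + (θ * n * Ke + (θ * n * r) ^ 2) * (4 * N / n) := by gcongr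
      _ = 4 * N * (θ * Ke) + θ * n * (4 * N * (θ * r ^ 2)) - θ * n * (ε / 4) := by
          field_simp
          ring
      _ ≤ 4 * N * (θ * Ke) + θ * n * (ε / 8) - θ * n * (ε / 4) := by gcongr
      _ = _ := by ring
  rw [← ofReal_measureReal]
  refine ENNReal.ofReal_le_ofReal (le_trans ?_ hexp)
  calc ℙ.real {ω | X (n + 1) ω - xstar < -ε}
      ≤ ℙ.real (⋃ k ∈ Finset.Icc (n / N) n,
          {ω | ∑ j ∈ Finset.Ico k (n + 1), Z (j + 1) ω ≤ -(ε / 4)}) := by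
        refine ENNReal.toReal_mono (measure_ne_top _ _) (measure_mono_ae ?_)
        filter_upwards [hpath] with ω h hω
        obtain ⟨k, hk, hsum⟩ := hn _ _ _ h hω
        exact mem_iUnion₂.2 ⟨k, hk, hsum⟩
    _ ≤ ∑ k ∈ Finset.Icc (n / N) n,
          ℙ.real {ω | ∑ j ∈ Finset.Ico k (n + 1), Z (j + 1) ω ≤ -(ε / 4)} :=
        measureReal_biUnion_finset_le _ _
    _ ≤ (Finset.Icc (n / N) n).card • Real.exp (4 * N * (θ * Ke) - 2 * (θ * ε / 16) * n) :=
        Finset.sum_le_card_nsmul _ _ _ hwindow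
    _ ≤ _ := by
        rw [nsmul_eq_mul]
        gcongr
        rw [Nat.card_Icc]
        exact_mod_cast Nat.sub_le _ _
end

section
/- Let K = K(H_1, H_2) be a positive constant such that |𝔼[ΔM_{n+1}/T_{n+1} | ℱ_n]| ≤ K/T_n² almost surely for all n, and write m := min{H_1, H_2}. For any given β > 1 and any ε with 0 < ε ≤ 4β(H_1+H_2)² log β / m, there exists a positive integer k_0 such that for all k > k_0 and all sufficiently large n, ℙ(|Σ_{i=k}^n ΔM_{i+1}/T_{i+1}| ≥ ε) ≤ 2 exp( − (ε − (K/(4m²)) Σ_{i=k}^n i^{−2})² / ( (8β(H_1+H_2)²/m²) Σ_{i=k}^n i^{−2} ) ). -/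
open MeasureTheory Filter Set

theorem sinh_le_mul_cosh {x : ℝ} (hx : 0 ≤ x) : Real.sinh x ≤ x * Real.cosh x := by
  have hmono : MonotoneOn (fun y : ℝ => y * Real.cosh y - Real.sinh y) (Set.Ici 0) := by
    refine monotoneOn_of_hasDerivWithinAt_nonneg (f' := fun y => y * Real.sinh y)
      (convex_Ici 0) (by fun_prop) (fun y _ => ?_) (fun y hy => ?_)
    · have h := ((hasDerivAt_id y).mul (Real.hasDerivAt_cosh y)).sub (Real.hasDerivAt_sinh y)
      refine (h.congr_deriv ?_).hasDerivWithinAt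
      simp
    · rw [interior_Ici] at hy
      exact mul_nonneg (le_of_lt hy) (Real.sinh_nonneg_iff.2 (le_of_lt hy))
  have h := hmono (Set.mem_Ici.2 le_rfl) (Set.mem_Ici.2 hx) hx
  simp at h
  linarith

/-- The chord bound for the exponential on `[-c, c]`. -/
theorem exp_mul_le_cosh_add_sinh_div_mul {c w : ℝ} (l : ℝ) (hc : 0 < c) (hw : |w| ≤ c) :
    Real.exp (l * w) ≤ Real.cosh (l * c) + Real.sinh (l * c) / c * w := by
  obtain ⟨h1, h2⟩ := abs_le.1 hw
  have ha : 0 ≤ (c + w) / (2 * c) := div_nonneg (by linarith) (by linarith)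
  have hb : 0 ≤ (c - w) / (2 * c) := div_nonneg (by linarith) (by linarith)
  have h := convexOn_exp.2 (Set.mem_univ (l * c)) (Set.mem_univ (-(l * c))) ha hb
    (by field_simp; ring)
  have e1 : ((c + w) / (2 * c)) • (l * c) + ((c - w) / (2 * c)) • (-(l * c)) = l * w := by
    simp only [smul_eq_mul]; field_simp; ring
  rw [e1] at h
  refine h.trans_eq ?_
  rw [Real.cosh_eq, Real.sinh_eq]
  simp only [smul_eq_mul]; field_simp; ring

theorem cosh_add_sinh_div_mul_le_exp {c d l : ℝ} (hl : 0 ≤ l) (hc : 0 < c) (hd : 0 ≤ d) :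
    Real.cosh (l * c) + Real.sinh (l * c) / c * d ≤ Real.exp (l ^ 2 * c ^ 2 / 2 + l * d) := by
  have h1 : Real.sinh (l * c) / c ≤ l * Real.cosh (l * c) := by
    rw [div_le_iff₀ hc]
    linarith [sinh_le_mul_cosh (mul_nonneg hl hc.le)]
  calc Real.cosh (l * c) + Real.sinh (l * c) / c * d
      ≤ Real.cosh (l * c) + l * Real.cosh (l * c) * d := by gcongr
    _ = Real.cosh (l * c) * (l * d + 1) := by ring
    _ ≤ Real.exp ((l * c) ^ 2 / 2) * Real.exp (l * d) := by
        gcongr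
        · exact Real.cosh_le_exp_half_sq _
        · exact Real.add_one_le_exp _
    _ = _ := by rw [← Real.exp_add]; ring_nf

section BoundedIncrements

variable {Ω : Type*} {m m0 : MeasurableSpace Ω} {μ : Measure Ω}

theorem integral_mul_exp_le_of_condExp_le [IsFiniteMeasure μ] (hm : m ≤ m0)
    {U W : Ω → ℝ} {B c d l : ℝ} (hl : 0 ≤ l) (hc : 0 < c) (hd : 0 ≤ d)
    (hU : StronglyMeasurable[m] U) (hU0 : 0 ≤ U) (hUB : ∀ᵐ ω ∂μ, U ω ≤ B)
    (hW : AEStronglyMeasurable W μ) (hWc : ∀ᵐ ω ∂μ, |W ω| ≤ c)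
    (hWd : ∀ᵐ ω ∂μ, (μ[W | m]) ω ≤ d) :
    ∫ ω, U ω * Real.exp (l * W ω) ∂μ
      ≤ Real.exp (l ^ 2 * c ^ 2 / 2 + l * d) * ∫ ω, U ω ∂μ := by
  have hWi : Integrable W μ := Integrable.of_bound hW c hWc
  have hUn : ∀ᵐ ω ∂μ, ‖U ω‖ ≤ B := by
    filter_upwards [hUB] with ω h
    rwa [Real.norm_of_nonneg (hU0 ω)]
  have hUm : AEStronglyMeasurable U μ := (hU.mono hm).aestronglyMeasurable
  have hUi : Integrable U μ := Integrable.of_bound hUm B hUn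
  have hUW : Integrable (U * W) μ := hWi.bdd_mul hUm hUn
  have hUE : Integrable (U * μ[W | m]) μ := integrable_condExp.bdd_mul hUm hUn
  have hexp : Integrable (fun ω => U ω * Real.exp (l * W ω)) μ := by
    refine Integrable.mul_bdd (c := Real.exp (l * c)) hUi
      (Real.continuous_exp.comp_aestronglyMeasurable (hW.const_mul l)) ?_
    filter_upwards [hWc] with ω h
    rw [Real.norm_of_nonneg (Real.exp_pos _).le]
    gcongr
    exact (le_abs_self _).trans h
  set A := Real.cosh (l * c)
  set S := Real.sinh (l * c) / c
  have hS : 0 ≤ S := div_nonneg (Real.sinh_nonneg_iff.2 (by positivity)) hc.le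
  have hdrift : ∫ ω, (U * W) ω ∂μ ≤ d * ∫ ω, U ω ∂μ := by
    rw [← integral_condExp hm,
      integral_congr_ae (condExp_mul_of_stronglyMeasurable_left hU hUW hWi), ← integral_const_mul]
    refine integral_mono_ae hUE (hUi.const_mul d) ?_
    filter_upwards [hWd] with ω h
    rw [Pi.mul_apply, mul_comm]
    exact mul_le_mul_of_nonneg_right h (hU0 ω)
  calc ∫ ω, U ω * Real.exp (l * W ω) ∂μ
      ≤ ∫ ω, (A * U ω + S * (U * W) ω) ∂μ := by
        refine integral_mono_ae hexp ((hUi.const_mul A).add (hUW.const_mul S)) ?_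
        filter_upwards [hWc] with ω h
        have := mul_le_mul_of_nonneg_left (exp_mul_le_cosh_add_sinh_div_mul l hc h) (hU0 ω)
        refine this.trans_eq ?_
        simp only [Pi.mul_apply]
        ring
    _ = A * ∫ ω, U ω ∂μ + S * ∫ ω, (U * W) ω ∂μ := by
        rw [integral_add (hUi.const_mul A) (hUW.const_mul S), integral_const_mul,
          integral_const_mul]
    _ ≤ A * ∫ ω, U ω ∂μ + S * (d * ∫ ω, U ω ∂μ) := by gcongr
    _ = (A + S * d) * ∫ ω, U ω ∂μ := by ring
    _ ≤ _ := mul_le_mul_of_nonneg_right (cosh_add_sinh_div_mul_le_exp hl hc hd)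
        (integral_nonneg hU0)

theorem ae_sum_Ico_le {W : ℕ → Ω → ℝ} {c : ℕ → ℝ} {k : ℕ}
    (hWc : ∀ i ≥ k, ∀ᵐ ω ∂μ, |W i ω| ≤ c i) (n : ℕ) :
    ∀ᵐ ω ∂μ, ∑ i ∈ Finset.Ico k n, W i ω ≤ ∑ i ∈ Finset.Ico k n, c i := by
  have h : ∀ᵐ ω ∂μ, ∀ i, i ≥ k → |W i ω| ≤ c i := by
    rw [ae_all_iff]
    intro i
    by_cases hi : i ≥ k
    · filter_upwards [hWc i hi] with ω hω _ using hω
    · exact Eventually.of_forall fun ω h => absurd h hi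
  filter_upwards [h] with ω hω
  exact Finset.sum_le_sum fun i hi =>
    (le_abs_self _).trans (hω i (Finset.mem_Ico.1 hi).1)

theorem stronglyMeasurable_sum_Ico {ℱ : Filtration ℕ m0} {W : ℕ → Ω → ℝ}
    (hW : ∀ i, StronglyMeasurable[ℱ (i + 1)] (W i)) (k n : ℕ) :
    StronglyMeasurable[ℱ n] fun ω => ∑ i ∈ Finset.Ico k n, W i ω :=
  Finset.stronglyMeasurable_fun_sum _ fun i hi =>
    (hW i).mono (ℱ.mono (Finset.mem_Ico.1 hi).2)

theorem integral_exp_sum_le [IsProbabilityMeasure μ] {ℱ : Filtration ℕ m0}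
    {W : ℕ → Ω → ℝ} {c d : ℕ → ℝ} {k : ℕ} {l : ℝ} (hl : 0 ≤ l)
    (hc : ∀ i ≥ k, 0 < c i) (hd : ∀ i ≥ k, 0 ≤ d i)
    (hW : ∀ i, StronglyMeasurable[ℱ (i + 1)] (W i))
    (hWc : ∀ i ≥ k, ∀ᵐ ω ∂μ, |W i ω| ≤ c i)
    (hWd : ∀ i ≥ k, ∀ᵐ ω ∂μ, (μ[W i | ℱ i]) ω ≤ d i) {n : ℕ} (hn : k ≤ n) :
    ∫ ω, Real.exp (l * ∑ i ∈ Finset.Ico k n, W i ω) ∂μ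
      ≤ Real.exp (l ^ 2 * (∑ i ∈ Finset.Ico k n, c i ^ 2) / 2
          + l * ∑ i ∈ Finset.Ico k n, d i) := by
  induction n, hn using Nat.le_induction with
  | base => simp
  | succ n hn ih =>
    have hstep := integral_mul_exp_le_of_condExp_le (μ := μ) (ℱ.le n)
      (U := fun ω => Real.exp (l * ∑ i ∈ Finset.Ico k n, W i ω))
      (B := Real.exp (l * ∑ i ∈ Finset.Ico k n, c i)) hl (hc n hn) (hd n hn)
      (Real.continuous_exp.comp_stronglyMeasurable
        ((stronglyMeasurable_sum_Ico hW k n).const_mul l))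
      (fun ω => (Real.exp_pos _).le)
      (by
        filter_upwards [ae_sum_Ico_le hWc n] with ω h
        gcongr)
      ((hW n).mono (ℱ.le _)).aestronglyMeasurable (hWc n hn) (hWd n hn)
    simp only [Finset.sum_Ico_succ_top hn, mul_add, Real.exp_add (l * _)]
    refine hstep.trans ((mul_le_mul_of_nonneg_left ih (Real.exp_pos _).le).trans_eq ?_)
    rw [← Real.exp_add]
    ring_nf

theorem measureReal_le_sum_le_exp [IsProbabilityMeasure μ] {ℱ : Filtration ℕ m0}
    {W : ℕ → Ω → ℝ} {c d : ℕ → ℝ} {k : ℕ} {ε : ℝ}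
    (hc : ∀ i ≥ k, 0 < c i) (hd : ∀ i ≥ k, 0 ≤ d i)
    (hW : ∀ i, StronglyMeasurable[ℱ (i + 1)] (W i))
    (hWc : ∀ i ≥ k, ∀ᵐ ω ∂μ, |W i ω| ≤ c i)
    (hWd : ∀ i ≥ k, ∀ᵐ ω ∂μ, (μ[W i | ℱ i]) ω ≤ d i) {n : ℕ} (hn : k < n)
    (hε : ∑ i ∈ Finset.Ico k n, d i ≤ ε) :
    μ.real {ω | ε ≤ ∑ i ∈ Finset.Ico k n, W i ω}
      ≤ Real.exp (-(ε - ∑ i ∈ Finset.Ico k n, d i) ^ 2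
          / (2 * ∑ i ∈ Finset.Ico k n, c i ^ 2)) := by
  set D := ∑ i ∈ Finset.Ico k n, d i
  set V := ∑ i ∈ Finset.Ico k n, c i ^ 2 with hVdef
  have hV : 0 < V := Finset.sum_pos
    (fun i hi => pow_pos (hc i (Finset.mem_Ico.1 hi).1) 2) (Finset.nonempty_Ico.2 hn)
  have hl : 0 ≤ (ε - D) / V := div_nonneg (by linarith) hV.le
  have hint : Integrable
      (fun ω => Real.exp ((ε - D) / V * ∑ i ∈ Finset.Ico k n, W i ω)) μ := by
    refine Integrable.of_bound (C := Real.exp ((ε - D) / V * ∑ i ∈ Finset.Ico k n, c i))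
      (Real.continuous_exp.comp_stronglyMeasurable
        (((stronglyMeasurable_sum_Ico hW k n).mono (ℱ.le n)).const_mul _)).aestronglyMeasurable ?_
    filter_upwards [ae_sum_Ico_le hWc n] with ω h
    rw [Real.norm_of_nonneg (Real.exp_pos _).le]
    gcongr
  refine (ProbabilityTheory.measure_ge_le_exp_mul_mgf ε hl hint).trans ?_
  refine (mul_le_mul_of_nonneg_left (integral_exp_sum_le hl hc hd hW hWc hWd hn.le)
    (Real.exp_pos _).le).trans_eq ?_
  rw [← Real.exp_add]
  congr 1
  change -((ε - D) / V) * ε + (((ε - D) / V) ^ 2 * V / 2 + (ε - D) / V * D) = _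
  field_simp
  ring

/-- Azuma-Hoeffding inequality for bounded increments with small conditional drift. -/
theorem measureReal_le_abs_sum_le_exp [IsProbabilityMeasure μ] {ℱ : Filtration ℕ m0}
    {W : ℕ → Ω → ℝ} {c d : ℕ → ℝ} {k : ℕ} {ε : ℝ}
    (hc : ∀ i ≥ k, 0 < c i)
    (hW : ∀ i, StronglyMeasurable[ℱ (i + 1)] (W i))
    (hWc : ∀ i ≥ k, ∀ᵐ ω ∂μ, |W i ω| ≤ c i) (hd : ∀ i ≥ k, 0 ≤ d i)
    (hWd : ∀ i ≥ k, ∀ᵐ ω ∂μ, |(μ[W i | ℱ i]) ω| ≤ d i) {n : ℕ} (hn : k < n)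
    (hε : ∑ i ∈ Finset.Ico k n, d i ≤ ε) :
    μ.real {ω | ε ≤ |∑ i ∈ Finset.Ico k n, W i ω|}
      ≤ 2 * Real.exp (-(ε - ∑ i ∈ Finset.Ico k n, d i) ^ 2
          / (2 * ∑ i ∈ Finset.Ico k n, c i ^ 2)) := by
  have hpos := measureReal_le_sum_le_exp hc hd hW hWc
    (fun i hi => (hWd i hi).mono fun ω h => (le_abs_self _).trans h) hn hε
  have hneg := measureReal_le_sum_le_exp (W := fun i => -W i) hc hd (fun i => (hW i).neg)
    (fun i hi => (hWc i hi).mono fun ω h => by simpa using h)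
    (fun i hi => by
      filter_upwards [hWd i hi, condExp_neg (μ := μ) (W i) (ℱ i)] with ω h h'
      rw [h']
      exact (neg_le_abs _).trans h) hn hε
  have hset : {ω | ε ≤ |∑ i ∈ Finset.Ico k n, W i ω|}
      = {ω | ε ≤ ∑ i ∈ Finset.Ico k n, W i ω}
        ∪ {ω | ε ≤ ∑ i ∈ Finset.Ico k n, (-W i) ω} := by
    ext ω
    simp [le_abs]
  rw [hset, two_mul]
  exact (measureReal_union_le _ _).trans (add_le_add hpos hneg)

end BoundedIncrements

theorem sum_Ico_one_div_sq_le {k : ℕ} (hk : 1 ≤ k) (n : ℕ) :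
    ∑ i ∈ Finset.Ico k n, (1 : ℝ) / (i : ℝ) ^ 2 ≤ 2 / k := by
  obtain ⟨j, rfl⟩ := Nat.exists_eq_add_of_le' hk
  have h := sum_Ioo_inv_sq_le (α := ℝ) j n
  have hset : Finset.Ico (j + 1) n = Finset.Ioo j n := by
    ext i
    simp
  rw [hset]
  simpa using h

/-- Changing the drift constant costs at most the factor `β > 1` in the variance once the
drift `a` is small compared with `ε`. -/
theorem neg_sq_div_le_neg_sq_div {β ε a b v : ℝ} (hβ : 1 < β) (hv : 0 < v)
    (hb : 0 ≤ b) (hba : b ≤ a) (ha : a ≤ (β - 1) / (2 * β) * ε) (haε : a ≤ ε) :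
    -(ε - a) ^ 2 / v ≤ -(ε - b) ^ 2 / (β * v) := by
  have hβ0 : 0 < β := by linarith
  rw [div_le_div_iff₀ hv (by positivity)]
  have hε : 0 ≤ ε := by linarith
  have h2 : (β + 1) / (2 * β) * ε ≤ ε - a := by
    have : (β + 1) / (2 * β) * ε = ε - (β - 1) / (2 * β) * ε := by field_simp; ring
    linarith
  have h3 : ((β + 1) / (2 * β) * ε) ^ 2 ≤ (ε - a) ^ 2 := by gcongr
  have h4 : ε ^ 2 ≤ β * ((β + 1) / (2 * β) * ε) ^ 2 := by
    have : β * ((β + 1) / (2 * β) * ε) ^ 2 = ε ^ 2 + (β - 1) ^ 2 / (4 * β) * ε ^ 2 := by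
      field_simp; ring
    rw [this]
    have : 0 ≤ (β - 1) ^ 2 / (4 * β) * ε ^ 2 := by positivity
    linarith
  have h5 : (ε - b) ^ 2 ≤ ε ^ 2 := by nlinarith
  have h6 : (ε - b) ^ 2 ≤ β * (ε - a) ^ 2 := by nlinarith
  nlinarith

/-- Exponential inequality for the martingale sums Σ_{i=k}^n ΔM_{i+1}/T_{i+1}. -/
theorem martingale_sum_exponential_inequality
    (H11 H12 H21 H22 : ℝ)
    (hH11 : 0 ≤ H11) (hH22 : 0 ≤ H22) (hH12 : 0 < H12) (hH21 : 0 < H21)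
    (H1 H2 : ℝ) (hH1 : H1 = H11 + H21) (hH2 : H2 = H12 + H22) (hHne : H1 ≠ H2)
    (f : ℝ → ℝ)
    (hf_cont : ContinuousOn f (Set.Icc 0 1))
    (hf_mono : MonotoneOn f (Set.Icc 0 1))
    (hf_diff : DifferentiableOn ℝ f (Set.Icc 0 1))
    (hf0 : f 0 = 0) (hf1 : f 1 = 1)
    (hf_pos : ∀ x ∈ Set.Ioc (0:ℝ) 1, 0 < f x)
    {Ω : Type*} {m0 : MeasurableSpace Ω} {ℙ : Measure Ω} [IsProbabilityMeasure ℙ]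
    (ℱ : Filtration ℕ m0)
    (X : ℕ → Ω → Bool)
    (hX_meas : ∀ n : ℕ, Measurable[ℱ (n + 1)] (X (n + 1)))
    (Y1 Y2 : ℕ → Ω → ℝ)
    (hY1_meas : ∀ n : ℕ, Measurable[ℱ n] (Y1 n))
    (hY2_meas : ∀ n : ℕ, Measurable[ℱ n] (Y2 n))
    (hY1_ge : ∀ n ω, 1 ≤ Y1 n ω) (hY2_ge : ∀ n ω, 1 ≤ Y2 n ω)
    (T : ℕ → Ω → ℝ) (hT : ∀ n ω, T n ω = Y1 n ω + Y2 n ω)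
    (hdraw1 : ∀ n : ℕ,
      ℙ[(fun ω => if X (n + 1) ω then (1 : ℝ) else 0) | ℱ n]
        =ᵐ[ℙ] fun ω => f (Y1 n ω / T n ω) / (f (Y1 n ω / T n ω) + f (Y2 n ω / T n ω)))
    (hdraw2 : ∀ n : ℕ,
      ℙ[(fun ω => if X (n + 1) ω then (0 : ℝ) else 1) | ℱ n]
        =ᵐ[ℙ] fun ω => f (Y2 n ω / T n ω) / (f (Y1 n ω / T n ω) + f (Y2 n ω / T n ω)))
    (hupd1 : ∀ n ω, Y1 (n + 1) ω = Y1 n ω + (if X (n + 1) ω then H11 else H12))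
    (hupd2 : ∀ n ω, Y2 (n + 1) ω = Y2 n ω + (if X (n + 1) ω then H21 else H22))
    (Z : ℕ → Ω → ℝ) (hZ : ∀ n ω, Z n ω = Y1 n ω / T n ω)
    (L : ℕ → Ω → ℝ)
    (hL : ∀ n ω, L (n + 1) ω =
      if X (n + 1) ω then H11 - Z n ω * H1 else H12 - Z n ω * H2)
    (ΔM : ℕ → Ω → ℝ)
    (hΔM : ∀ n : ℕ, ΔM (n + 1) = L (n + 1) - ℙ[L (n + 1) | ℱ n])
    (K : ℝ) (hK : 0 < K)
    (hKprop : ∀ n : ℕ, ∀ᵐ ω ∂ℙ,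
      |(ℙ[fun ω' => ΔM (n + 1) ω' / T (n + 1) ω' | ℱ n]) ω| ≤ K / (T n ω) ^ 2) :
    ∀ β > (1:ℝ), ∀ ε : ℝ, 0 < ε →
      ε ≤ 4 * β * (H1 + H2) ^ 2 * Real.log β / min H1 H2 →
      ∃ k0 : ℕ, ∀ k > k0, ∀ᶠ n in atTop,
        ℙ {ω | ε ≤ |∑ i ∈ Finset.Icc k n, ΔM (i + 1) ω / T (i + 1) ω|} ≤
          ENNReal.ofReal (2 * Real.exp
            (-(ε - K / (4 * (min H1 H2) ^ 2) *
                  ∑ i ∈ Finset.Icc k n, (1 : ℝ) / (i : ℝ) ^ 2) ^ 2 /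
              (8 * β * (H1 + H2) ^ 2 / (min H1 H2) ^ 2 *
                  ∑ i ∈ Finset.Icc k n, (1 : ℝ) / (i : ℝ) ^ 2))) := by
  intro β hβ ε hε _
  have hH1pos : 0 < H1 := by linarith
  have hH2pos : 0 < H2 := by linarith
  set m := min H1 H2
  have hm : 0 < m := lt_min hH1pos hH2pos
  set h := H1 + H2
  have hhpos : 0 < h := by linarith
  have hTpos : ∀ n ω, 0 < T n ω := fun n ω => by
    rw [hT]; linarith [hY1_ge n ω, hY2_ge n ω]
  have hT_ge : ∀ n ω, m * n ≤ T n ω := by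
    intro n ω
    induction n with
    | zero => simpa using (hTpos 0 ω).le
    | succ n ih =>
      have hstep : m ≤ T (n + 1) ω - T n ω := by
        rw [hT, hT, hupd1, hupd2]
        split_ifs
        · linarith [min_le_left H1 H2]
        · linarith [min_le_right H1 H2]
      push_cast
      linarith
  have hXm : ∀ n, MeasurableSet[ℱ (n + 1)] {ω | X (n + 1) ω = true} := fun n =>
    hX_meas n (measurableSet_singleton true)
  have hTm : ∀ n, Measurable[ℱ n] (T n) := fun n => by
    rw [show T n = Y1 n + Y2 n from funext (hT n)]
    exact (hY1_meas n).add (hY2_meas n)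
  have hZm : ∀ n, Measurable[ℱ n] (Z n) := fun n => by
    rw [show Z n = Y1 n / T n from funext (hZ n)]
    exact (hY1_meas n).div (hTm n)
  have hLm : ∀ n, Measurable[ℱ (n + 1)] (L (n + 1)) := fun n => by
    rw [show L (n + 1) = fun ω => if X (n + 1) ω then H11 - Z n ω * H1 else H12 - Z n ω * H2
      from funext (hL n)]
    have hZ' : Measurable[ℱ (n + 1)] (Z n) := (hZm n).mono (ℱ.mono n.le_succ) le_rfl
    exact Measurable.ite (hXm n) ((hZ'.mul_const H1).const_sub H11)
      ((hZ'.mul_const H2).const_sub H12)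
  have hLb : ∀ n ω, |L (n + 1) ω| ≤ h := by
    intro n ω
    have hZ0 : 0 ≤ Z n ω := by
      rw [hZ]; exact div_nonneg (by linarith [hY1_ge n ω]) (hTpos n ω).le
    have hZ1 : Z n ω ≤ 1 := by
      rw [hZ, div_le_one (hTpos n ω), hT]; linarith [hY2_ge n ω]
    rw [hL]
    split_ifs
    · rw [abs_le]; constructor <;> nlinarith
    · rw [abs_le]; constructor <;> nlinarith
  have hΔb : ∀ n, ∀ᵐ ω ∂ℙ, |ΔM (n + 1) ω| ≤ 2 * h := fun n => by
    have := ae_bdd_abs_condExp_of_ae_bdd_abs (μ := ℙ) (m := ℱ n) (R := h)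
      (Eventually.of_forall (hLb n))
    filter_upwards [this] with ω hω
    rw [hΔM, Pi.sub_apply]
    linarith [abs_sub (L (n + 1) ω) ((ℙ[L (n + 1) | ℱ n]) ω), hLb n ω]
  set W : ℕ → Ω → ℝ := fun i ω => ΔM (i + 1) ω / T (i + 1) ω with hWdef
  have hWm : ∀ i, StronglyMeasurable[ℱ (i + 1)] (W i) := fun i => by
    refine Measurable.stronglyMeasurable (Measurable.div ?_ (hTm (i + 1)))
    rw [hΔM]
    exact (hLm i).sub
      (stronglyMeasurable_condExp.measurable.mono (ℱ.mono i.le_succ) le_rfl)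
  obtain ⟨N, hN⟩ := exists_nat_gt (2 * (K / m ^ 2) / ((β - 1) / (2 * β) * ε))
  refine ⟨N, fun k hk => ?_⟩
  have hk1 : 1 ≤ k := by omega
  have hipos : ∀ i ≥ k, (0 : ℝ) < i := fun i hi => by
    have : 0 < i := by omega
    exact_mod_cast this
  filter_upwards [eventually_ge_atTop k] with n hn
  have hIcc : Finset.Icc k n = Finset.Ico k (n + 1) := by
    ext i; simp
  rw [hIcc]
  set σ := ∑ i ∈ Finset.Ico k (n + 1), (1 : ℝ) / (i : ℝ) ^ 2 with hσ
  have hσpos : 0 < σ := Finset.sum_pos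
    (fun i hi => by have := hipos i (Finset.mem_Ico.1 hi).1; positivity)
    (Finset.nonempty_Ico.2 (by omega))
  have hδpos : 0 < (β - 1) / (2 * β) * ε := by
    have : 0 < β - 1 := by linarith
    positivity
  have hdrift : K / m ^ 2 * σ ≤ (β - 1) / (2 * β) * ε := by
    have hkpos := hipos k le_rfl
    have h1 : K / m ^ 2 * σ ≤ K / m ^ 2 * (2 / k) := by
      gcongr
      exact sum_Ico_one_div_sq_le hk1 _
    have hNk : (N : ℝ) < k := by exact_mod_cast hk
    have h2 : 2 * (K / m ^ 2) < k * ((β - 1) / (2 * β) * ε) :=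
      (div_lt_iff₀ hδpos).1 (hN.trans hNk)
    have h3 : K / m ^ 2 * (2 / k) ≤ (β - 1) / (2 * β) * ε := by
      rw [show K / m ^ 2 * (2 / k) = 2 * (K / m ^ 2) / k by ring, div_le_iff₀ hkpos]
      linarith
    exact h1.trans h3
  have hdriftε : K / m ^ 2 * σ ≤ ε := by
    refine hdrift.trans (mul_le_of_le_one_left hε.le ?_)
    rw [div_le_one (by linarith)]
    linarith
  have hsumd : ∑ i ∈ Finset.Ico k (n + 1), K / m ^ 2 * ((1 : ℝ) / (i : ℝ) ^ 2)
      = K / m ^ 2 * σ := by rw [hσ, Finset.mul_sum]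
  have hsumc : ∑ i ∈ Finset.Ico k (n + 1), (2 * h / (m * (i : ℝ))) ^ 2
      = 4 * h ^ 2 / m ^ 2 * σ := by
    rw [hσ, Finset.mul_sum]
    refine Finset.sum_congr rfl fun i hi => ?_
    have := hipos i (Finset.mem_Ico.1 hi).1
    field_simp
    ring
  have hmain := measureReal_le_abs_sum_le_exp (μ := ℙ) (ℱ := ℱ) (W := W)
    (c := fun i => 2 * h / (m * (i : ℝ))) (d := fun i => K / m ^ 2 * ((1 : ℝ) / (i : ℝ) ^ 2))
    (k := k) (ε := ε) (n := n + 1)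
    (fun i hi => by have := hipos i hi; positivity) hWm
    (fun i hi => by
      have hi0 := hipos i hi
      filter_upwards [hΔb i] with ω hω
      simp only [hWdef]
      rw [abs_div, abs_of_pos (hTpos (i + 1) ω)]
      have hTi : m * i ≤ T (i + 1) ω := by
        have := hT_ge (i + 1) ω
        push_cast at this
        linarith
      gcongr)
    (fun i hi => by positivity)
    (fun i hi => by
      have hi0 := hipos i hi
      filter_upwards [hKprop i] with ω hω
      refine hω.trans ?_
      rw [show K / m ^ 2 * (1 / (i : ℝ) ^ 2) = K / (m * i) ^ 2 by field_simp]
      have := hT_ge i ω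
      gcongr)
    (by omega) (by rw [hsumd]; exact hdriftε)
  rw [hsumd, hsumc] at hmain
  rw [← ofReal_measureReal]
  refine ENNReal.ofReal_le_ofReal (hmain.trans ?_)
  gcongr 2 * Real.exp ?_
  have hcomp := neg_sq_div_le_neg_sq_div (β := β) (ε := ε) (a := K / m ^ 2 * σ)
    (b := K / (4 * m ^ 2) * σ) (v := 2 * (4 * h ^ 2 / m ^ 2 * σ)) hβ (by positivity)
    (by positivity)
    (by gcongr; nlinarith [sq_nonneg m]) hdrift hdriftε
  refine hcomp.trans_eq ?_
  congr 1
  ring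
end
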